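/- Let α be a nonzero real number and let Q be the 3-dimensional real Leibniz algebra with bracket determined by [f,f]=e, [g,f]=e, [g,g]=αe (all other brackets of basis vectors zero). A linear map N : Q → Q is a Nijenhuis operator on Q if and only if its matrix (rows = coordinates of N(e), N(f), N(g) in the basis {e,f,g}) has one of the following forms for real parameters: (1) rows (k₁,0,0), (ℓ₁,k₁,0), (p₁,0,k₁), when α>1/4; (2) rows (k₁,0,0), (ℓ₁,k₁,0), (p₁, ((−1−√(1−4α))/2)(p₃−k₁), p₃), when α≤1/4 and α≠0; (3) rows (k₁,0,0), (ℓ₁,k₁,0), (p₁, ((−1+√(1−4α))/2)(p₃−k₁), p₃), when α<1/4, α≠0 and p₃≠k₁; (4) rows (ℓ₂+((1+√(1−4α))/2)ℓ₃, 0, 0), (ℓ₁,ℓ₂,ℓ₃), (p₁, ((1+√(1−4α))/2)(ℓ₂+((1+√(1−4α))/2)ℓ₃−p₃), p₃), when α≤1/4, α≠0 and ℓ₃≠0; (5) rows (ℓ₂+((1−√(1−4α))/2)ℓ₃, 0, 0), (ℓ₁,ℓ₂,ℓ₃), (p₁, ((1−√(1−4α))/2)(ℓ₂+((1−√(1−4α))/2)ℓ₃−p₃),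 p₃), when α<1/4, α≠0 and ℓ₃≠0. -/

import Mathlib

/-- Bracket of the 3-dim real Leibniz algebra with [f,f]=e, [g,f]=e, [g,g]=αe
(basis e,f,g ↔ indices 0,1,2). -/
noncomputable def br (α : ℝ) (x y : Fin 3 → ℝ) : Fin 3 → ℝ :=
  ![x 1 * y 1 + x 2 * y 1 + α * (x 2 * y 2), 0, 0]

/-- A linear map on `ℝ³` is determined by its values on the standard basis. -/
lemma apply_eq_basis_sum (N : (Fin 3 → ℝ) →ₗ[ℝ] (Fin 3 → ℝ)) (x : Fin 3 → ℝ) :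
    N x = x 0 • N ![1,0,0] + x 1 • N ![0,1,0] + x 2 • N ![0,0,1] := by
  simp only [← map_smul, ← map_add]
  congr 1
  ext i
  fin_cases i <;> simp

/-- The Nijenhuis condition as a system of polynomial equations: `N e` is a multiple of `e`, and
the rows of `N - k₁` span an isotropic subspace modulo `e`. -/
lemma nijenhuis_iff_equations (α : ℝ) (hα : α ≠ 0) (N : (Fin 3 → ℝ) →ₗ[ℝ] (Fin 3 → ℝ))
    (k₁ k₂ k₃ ℓ₁ ℓ₂ ℓ₃ p₁ p₂ p₃ : ℝ)
    (he : N ![1,0,0] = ![k₁,k₂,k₃]) (hf : N ![0,1,0] = ![ℓ₁,ℓ₂,ℓ₃])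
    (hg : N ![0,0,1] = ![p₁,p₂,p₃]) :
    (∀ x y, br α (N x) (N y) + N (N (br α x y)) = N (br α (N x) y) + N (br α x (N y))) ↔
      k₂ = 0 ∧ k₃ = 0 ∧
      (ℓ₂ - k₁) ^ 2 + (ℓ₂ - k₁) * ℓ₃ + α * ℓ₃ ^ 2 = 0 ∧
      p₂ ^ 2 + p₂ * (p₃ - k₁) + α * (p₃ - k₁) ^ 2 = 0 ∧
      (ℓ₂ - k₁) * p₂ + ℓ₃ * p₂ + α * ℓ₃ * (p₃ - k₁) = 0 ∧
      ℓ₃ * p₂ = (ℓ₂ - k₁) * (p₃ - k₁) := by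
  have hN : ∀ x, N x = ![x 0 * k₁ + x 1 * ℓ₁ + x 2 * p₁, x 0 * k₂ + x 1 * ℓ₂ + x 2 * p₂,
      x 0 * k₃ + x 1 * ℓ₃ + x 2 * p₃] := by
    intro x
    rw [apply_eq_basis_sum, he, hf, hg]
    simp
  constructor
  · intro h
    have hcoord : ∀ x y i, (br α (N x) (N y) + N (N (br α x y))) i
        = (N (br α (N x) y) + N (br α x (N y))) i := fun x y i => by rw [h x y]
    simp only [hN, br] at hcoord
    have hee := hcoord ![1,0,0] ![1,0,0] 0
    have hef₁ := hcoord ![1,0,0] ![0,1,0] 1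
    have hef₂ := hcoord ![1,0,0] ![0,1,0] 2
    have hff := hcoord ![0,1,0] ![0,1,0] 0
    have hfg := hcoord ![0,1,0] ![0,0,1] 0
    have hgf := hcoord ![0,0,1] ![0,1,0] 0
    have hgg := hcoord ![0,0,1] ![0,0,1] 0
    simp at hee hef₁ hef₂ hff hfg hgf hgg
    have hsum : k₂ + k₃ = 0 := by
      rcases hef₁ with h₁ | h₁ <;> rcases hef₂ with h₂ | h₂ <;> linarith
    have hk₃ : k₃ = 0 := by
      have : α * k₃ ^ 2 = 0 := by linear_combination hee - k₂ * hsum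
      simpa [hα] using this
    have hk₂ : k₂ = 0 := by linarith
    subst hk₂ hk₃
    refine ⟨rfl, rfl, ?_, ?_, ?_, ?_⟩
    · linear_combination hff
    · linear_combination hgg
    · linear_combination hfg
    · linear_combination hfg - hgf
  · rintro ⟨rfl, rfl, hff, hgg, hfg, hdet⟩ x y
    simp only [hN, br]
    ext i
    fin_cases i
    · simp
      linear_combination x 1 * y 1 * hff + x 2 * y 2 * hgg + x 1 * y 2 * hfg
        + x 2 * y 1 * (hfg - hdet)
    · simp
    · simp

/-- For `α > 1/4` the form `a² + ab + αb²` is definite. -/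
lemma eq_zero_of_isotropic {α a b : ℝ} (hα : 1/4 < α) (h : a ^ 2 + a * b + α * b ^ 2 = 0) :
    a = 0 ∧ b = 0 := by
  have hb : b = 0 := by
    by_contra hb
    have : 0 < (α - 1/4) * b ^ 2 := mul_pos (by linarith) (by positivity)
    nlinarith [sq_nonneg (a + b / 2)]
  subst hb
  exact ⟨by simpa using h, rfl⟩

/-- The isotropic vectors of `a² + ab + αb²` when its discriminant is a square `s²`. -/
lemma eq_or_eq_of_isotropic {α s a b : ℝ} (hs : s ^ 2 = 1 - 4 * α)
    (h : a ^ 2 + a * b + α * b ^ 2 = 0) :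
    a = (-1 - s) / 2 * b ∨ a = (-1 + s) / 2 * b := by
  have : (a - (-1 - s) / 2 * b) * (a - (-1 + s) / 2 * b) = 0 := by
    linear_combination h - b ^ 2 / 4 * hs
  simpa [sub_eq_zero] using this

theorem nijenhuis_classification_thm2_7 (α : ℝ) (hα : α ≠ 0)
    (N : (Fin 3 → ℝ) →ₗ[ℝ] (Fin 3 → ℝ)) :
    (∀ x y, br α (N x) (N y) + N (N (br α x y)) = N (br α (N x) y) + N (br α x (N y)))
    ↔
    ((α > 1/4 ∧ ∃ k₁ ℓ₁ p₁ : ℝ,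
        N ![1,0,0] = ![k₁,0,0] ∧ N ![0,1,0] = ![ℓ₁,k₁,0] ∧ N ![0,0,1] = ![p₁,0,k₁]) ∨
     (α ≤ 1/4 ∧ ∃ k₁ ℓ₁ p₁ p₃ : ℝ,
        N ![1,0,0] = ![k₁,0,0] ∧ N ![0,1,0] = ![ℓ₁,k₁,0] ∧
        N ![0,0,1] = ![p₁, ((-1 - Real.sqrt (1-4*α))/2) * (p₃-k₁), p₃]) ∨
     (α < 1/4 ∧ ∃ k₁ ℓ₁ p₁ p₃ : ℝ, p₃ ≠ k₁ ∧
        N ![1,0,0] = ![k₁,0,0] ∧ N ![0,1,0] = ![ℓ₁,k₁,0] ∧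
        N ![0,0,1] = ![p₁, ((-1 + Real.sqrt (1-4*α))/2) * (p₃-k₁), p₃]) ∨
     (α ≤ 1/4 ∧ ∃ ℓ₁ ℓ₂ ℓ₃ p₁ p₃ : ℝ, ℓ₃ ≠ 0 ∧
        N ![1,0,0] = ![ℓ₂ + ((1 + Real.sqrt (1-4*α))/2) * ℓ₃, 0, 0] ∧
        N ![0,1,0] = ![ℓ₁,ℓ₂,ℓ₃] ∧
        N ![0,0,1] = ![p₁, ((1 + Real.sqrt (1-4*α))/2) *
          (ℓ₂ + ((1 + Real.sqrt (1-4*α))/2) * ℓ₃ - p₃), p₃]) ∨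
     (α < 1/4 ∧ ∃ ℓ₁ ℓ₂ ℓ₃ p₁ p₃ : ℝ, ℓ₃ ≠ 0 ∧
        N ![1,0,0] = ![ℓ₂ + ((1 - Real.sqrt (1-4*α))/2) * ℓ₃, 0, 0] ∧
        N ![0,1,0] = ![ℓ₁,ℓ₂,ℓ₃] ∧
        N ![0,0,1] = ![p₁, ((1 - Real.sqrt (1-4*α))/2) *
          (ℓ₂ + ((1 - Real.sqrt (1-4*α))/2) * ℓ₃ - p₃), p₃])) := by
  obtain ⟨k₁, k₂, k₃, he⟩ : ∃ a b c, N ![1,0,0] = ![a,b,c] :=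
    ⟨_, _, _, (FinVec.etaExpand_eq _).symm⟩
  obtain ⟨ℓ₁, ℓ₂, ℓ₃, hf⟩ : ∃ a b c, N ![0,1,0] = ![a,b,c] :=
    ⟨_, _, _, (FinVec.etaExpand_eq _).symm⟩
  obtain ⟨p₁, p₂, p₃, hg⟩ : ∃ a b c, N ![0,0,1] = ![a,b,c] :=
    ⟨_, _, _, (FinVec.etaExpand_eq _).symm⟩
  constructor
  · intro h
    obtain ⟨rfl, rfl, hff, hgg, hfg, hdet⟩ :=
      (nijenhuis_iff_equations α hα N _ _ _ _ _ _ _ _ _ he hf hg).mp h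
    rcases lt_or_ge (1/4) α with hlt | hle
    · obtain ⟨ha, hb⟩ := eq_zero_of_isotropic hlt hff
      obtain ⟨hc, hd⟩ := eq_zero_of_isotropic hlt hgg
      obtain rfl : ℓ₂ = k₁ := by linarith
      obtain rfl : p₃ = ℓ₂ := by linarith
      subst hb hc
      exact Or.inl ⟨hlt, p₃, ℓ₁, p₁, he, hf, hg⟩
    · have hs : Real.sqrt (1-4*α) ^ 2 = 1-4*α := Real.sq_sqrt (by linarith)
      have hs0 : α = 1/4 → Real.sqrt (1-4*α) = 0 := by
        rintro rfl
        norm_num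
      rw [he, hf, hg]
      generalize Real.sqrt (1-4*α) = s at hs hs0
      have hαs : α = (1 - s ^ 2) / 4 := by linarith
      by_cases hb : ℓ₃ = 0
      · subst hb
        obtain rfl : ℓ₂ = k₁ := by
          have : (ℓ₂ - k₁) ^ 2 = 0 := by linear_combination hff
          exact sub_eq_zero.mp (by simpa using this)
        have hor : p₂ = (-1 - s) / 2 * (p₃ - ℓ₂) ∨ p₂ = (-1 + s) / 2 * (p₃ - ℓ₂) :=
          eq_or_eq_of_isotropic hs hgg
        by_cases hm : p₂ = (-1 - s) / 2 * (p₃ - ℓ₂)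
        · exact Or.inr (Or.inl ⟨hle, ℓ₂, ℓ₁, p₁, p₃, rfl, rfl, by rw [hm]⟩)
        · have hp := hor.resolve_left hm
          refine Or.inr (Or.inr (Or.inl ⟨lt_of_le_of_ne hle fun hq => hm ?_, ℓ₂, ℓ₁, p₁, p₃,
            fun hq => hm ?_, rfl, rfl, by rw [hp]⟩))
          · rw [hp, hs0 hq]
            ring
          · rw [hp, hq]
            ring
      · have hor : ℓ₂ - k₁ = (-1 - s) / 2 * ℓ₃ ∨ ℓ₂ - k₁ = (-1 + s) / 2 * ℓ₃ :=
          eq_or_eq_of_isotropic hs hff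
        have hp₂ : ∀ r, ℓ₂ - k₁ = r * ℓ₃ → p₂ = r * (p₃ - k₁) := fun r hr =>
          mul_left_cancel₀ hb (by rw [hdet, hr]; ring)
        by_cases hm : ℓ₂ - k₁ = (-1 - s) / 2 * ℓ₃
        · have hk : k₁ = ℓ₂ + (1 + s) / 2 * ℓ₃ := by linarith
          refine Or.inr (Or.inr (Or.inr (Or.inl ⟨hle, ℓ₁, ℓ₂, ℓ₃, p₁, p₃, hb, by rw [← hk],
            rfl, ?_⟩)))
          rw [← hk, hp₂ _ hm]
          congr 2
          ring
        · have hp := hor.resolve_left hm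
          have hk : k₁ = ℓ₂ + (1 - s) / 2 * ℓ₃ := by linarith
          refine Or.inr (Or.inr (Or.inr (Or.inr ⟨lt_of_le_of_ne hle fun hq => hm ?_,
            ℓ₁, ℓ₂, ℓ₃, p₁, p₃, hb, by rw [← hk], rfl, ?_⟩)))
          · rw [hp, hs0 hq]
            ring
          · rw [← hk, hp₂ _ hp]
            congr 2
            ring
  · have hs : α ≤ 1/4 → α = (1 - Real.sqrt (1-4*α) ^ 2) / 4 := fun hle => by
      rw [Real.sq_sqrt (by linarith)]
      ring
    rintro (⟨-, k₁, ℓ₁, p₁, he, hf, hg⟩ | ⟨hle, k₁, ℓ₁, p₁, p₃, he, hf, hg⟩ |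
      ⟨hlt, k₁, ℓ₁, p₁, p₃, -, he, hf, hg⟩ | ⟨hle, ℓ₁, ℓ₂, ℓ₃, p₁, p₃, -, he, hf, hg⟩ |
      ⟨hlt, ℓ₁, ℓ₂, ℓ₃, p₁, p₃, -, he, hf, hg⟩) <;>
      rw [nijenhuis_iff_equations α hα N _ _ _ _ _ _ _ _ _ he hf hg]
    · simp
    all_goals
      have hαs := hs (by linarith)
      generalize Real.sqrt (1-4*α) = s at hαs
      subst hαs
      refine ⟨rfl, rfl, ?_, ?_, ?_, ?_⟩ <;> ring
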